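/- Let B be a standard one-dimensional Brownian motion, α ∈ (0, 1/2) and s > 0. Then E[ ( B(s)/s^α + α ∫₀^s (B(s) - B(u)) / (s-u)^{1+α} du )² ] = s^{1-2α} / (1-2α). Equivalently, the Weyl-form fractional derivative satisfies E|D^α_{0+}B(s)|² = s^{1-2α} / ((1-2α) Γ(1-α)²). -/

import Mathlib

open MeasureTheory Real

lemma integral_abs_mul_le_of_integral_sq_le {Ω : Type*} [MeasurableSpace Ω] {μ : Measure Ω}
    {X Y : Ω → ℝ} {a b : ℝ} (hX : MemLp X 2 μ) (hY : MemLp Y 2 μ) (ha : 0 < a) (hb : 0 < b)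
    (hXa : ∫ ω, X ω ^ 2 ∂μ ≤ a ^ 2) (hYb : ∫ ω, Y ω ^ 2 ∂μ ≤ b ^ 2) :
    ∫ ω, |X ω * Y ω| ∂μ ≤ a * b := by
  have key : ∀ ω, |X ω * Y ω| ≤ b / (2 * a) * X ω ^ 2 + a / (2 * b) * Y ω ^ 2 := by
    intro ω
    rw [abs_mul, ← sq_abs (X ω), ← sq_abs (Y ω)]
    have h : b / (2 * a) * |X ω| ^ 2 + a / (2 * b) * |Y ω| ^ 2 - |X ω| * |Y ω|
        = (b * |X ω| - a * |Y ω|) ^ 2 / (2 * a * b) := by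
      field_simp
      ring
    have : 0 ≤ (b * |X ω| - a * |Y ω|) ^ 2 / (2 * a * b) := by positivity
    linarith
  calc ∫ ω, |X ω * Y ω| ∂μ
      ≤ ∫ ω, (b / (2 * a) * X ω ^ 2 + a / (2 * b) * Y ω ^ 2) ∂μ :=
        integral_mono (hX.integrable_mul hY).abs
          ((hX.integrable_sq.const_mul _).add (hY.integrable_sq.const_mul _)) key
    _ = b / (2 * a) * ∫ ω, X ω ^ 2 ∂μ + a / (2 * b) * ∫ ω, Y ω ^ 2 ∂μ := by
        rw [integral_add (hX.integrable_sq.const_mul _) (hY.integrable_sq.const_mul _),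
          integral_const_mul, integral_const_mul]
    _ ≤ b / (2 * a) * a ^ 2 + a / (2 * b) * b ^ 2 := by gcongr
    _ = a * b := by field_simp; ring

section
variable {T Ω : Type*} [MeasurableSpace T] [MeasurableSpace Ω] {μ : Measure Ω} {ν : Measure T}
  [SFinite ν] {F : T → Ω → ℝ} {g : T → ℝ}

lemma ae_integrable_of_integral_sq_le [IsProbabilityMeasure μ]
    (hF : Measurable fun q : T × Ω => F q.1 q.2) (hg : Integrable g ν)
    (hbound : ∀ᵐ t ∂ν, 0 < g t ∧ MemLp (F t) 2 μ ∧ ∫ ω, F t ω ^ 2 ∂μ ≤ g t ^ 2) :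
    ∀ᵐ ω ∂μ, Integrable (fun t => F t ω) ν := by
  have hint : Integrable (fun q : T × Ω => F q.1 q.2) (ν.prod μ) := by
    rw [integrable_prod_iff hF.aestronglyMeasurable]
    refine ⟨hbound.mono fun t ht => ht.2.1.integrable one_le_two, ?_⟩
    refine hg.mono' hF.aestronglyMeasurable.norm.integral_prod_right' ?_
    filter_upwards [hbound] with t ht
    rw [Real.norm_of_nonneg (integral_nonneg fun _ => norm_nonneg _)]
    simpa using integral_abs_mul_le_of_integral_sq_le ht.2.1
      (memLp_const (1 : ℝ)) ht.1 one_pos ht.2.2 (by simp)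
  exact hint.prod_left_ae

lemma integral_sq_integral_eq [SFinite μ]
    (hF : Measurable fun q : T × Ω => F q.1 q.2) (hg : Integrable g ν)
    (hbound : ∀ᵐ t ∂ν, 0 < g t ∧ MemLp (F t) 2 μ ∧ ∫ ω, F t ω ^ 2 ∂μ ≤ g t ^ 2) :
    ∫ ω, (∫ t, F t ω ∂ν) ^ 2 ∂μ = ∫ x, ∫ y, ∫ ω, F x ω * F y ω ∂μ ∂ν ∂ν := by
  have hmeas : Measurable fun q : (T × T) × Ω => F q.1.1 q.2 * F q.1.2 q.2 :=
    (hF.comp (by fun_prop : Measurable fun q : (T × T) × Ω => (q.1.1, q.2))).mul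
      (hF.comp (by fun_prop : Measurable fun q : (T × T) × Ω => (q.1.2, q.2)))
  have hint : Integrable (fun q : (T × T) × Ω => F q.1.1 q.2 * F q.1.2 q.2)
      ((ν.prod ν).prod μ) := by
    rw [integrable_prod_iff hmeas.aestronglyMeasurable]
    have h1 := Measure.quasiMeasurePreserving_fst (μ := ν) (ν := ν) |>.ae hbound
    have h2 := Measure.quasiMeasurePreserving_snd (μ := ν) (ν := ν) |>.ae hbound
    refine ⟨?_, (hg.mul_prod hg).mono'
      hmeas.aestronglyMeasurable.norm.integral_prod_right' ?_⟩
    · filter_upwards [h1, h2] with p hp hq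
      exact hp.2.1.integrable_mul hq.2.1
    · filter_upwards [h1, h2] with p hp hq
      rw [Real.norm_of_nonneg (integral_nonneg fun _ => norm_nonneg _)]
      exact integral_abs_mul_le_of_integral_sq_le hp.2.1 hq.2.1 hp.1 hq.1 hp.2.2 hq.2.2
  calc ∫ ω, (∫ t, F t ω ∂ν) ^ 2 ∂μ
      = ∫ ω, ∫ p, F p.1 ω * F p.2 ω ∂(ν.prod ν) ∂μ := by
        refine integral_congr_ae (.of_forall fun ω => ?_)
        simp only [sq]
        exact (integral_prod_mul (fun t => F t ω) (fun t => F t ω)).symm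
    _ = ∫ p, ∫ ω, F p.1 ω * F p.2 ω ∂μ ∂(ν.prod ν) := (integral_integral_swap hint).symm
    _ = _ := integral_prod _ hint.integral_prod_left

end

/-- The function is integrable on `(0, s)`, with the stated integral. -/
lemma integral_rpow_mul_min {α s x : ℝ} (hα : 0 < α) (hα' : α < 1) (hx : 0 < x) (hxs : x ≤ s) :
    IntervalIntegrable (fun y => y ^ (-1 - α) * min x y) volume 0 s ∧
    ∫ y in (0 : ℝ)..s, y ^ (-1 - α) * min x y
      = x ^ (1 - α) / (1 - α) + x * (x ^ (-α) - s ^ (-α)) / α := by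
  have hl : ∀ y ∈ Set.Ioo 0 x, y ^ (-α) = y ^ (-1 - α) * min x y := by
    intro y hy
    rw [min_eq_right hy.2.le, ← Real.rpow_add_one hy.1.ne']
    ring_nf
  have hr : ∀ y ∈ Set.Ioo x s, x * y ^ (-1 - α) = y ^ (-1 - α) * min x y := by
    intro y hy
    rw [min_eq_left hy.1.le, mul_comm]
  have h0 : (0 : ℝ) ∉ Set.uIcc x s := by
    rw [Set.uIcc_of_le hxs]
    exact fun h => hx.not_ge h.1
  have il : IntervalIntegrable (fun y => y ^ (-1 - α) * min x y) volume 0 x :=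
    (intervalIntegral.intervalIntegrable_rpow' (by linarith : -1 < -α)).congr_uIoo (by
      rw [Set.uIoo_of_le hx.le]; exact hl)
  have ir : IntervalIntegrable (fun y => y ^ (-1 - α) * min x y) volume x s :=
    ((intervalIntegral.intervalIntegrable_rpow (Or.inr h0)).const_mul x).congr_uIoo (by
      rw [Set.uIoo_of_le hxs]; exact hr)
  refine ⟨il.trans ir, ?_⟩
  rw [← intervalIntegral.integral_add_adjacent_intervals il ir,
    ← intervalIntegral.integral_congr_Ioo_of_le hx.le hl,
    ← intervalIntegral.integral_congr_Ioo_of_le hxs hr,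
    intervalIntegral.integral_const_mul, integral_rpow (Or.inl (by linarith)),
    integral_rpow (Or.inr ⟨by linarith, h0⟩)]
  rw [show -α + 1 = 1 - α by ring, show -1 - α + 1 = -α by ring,
    Real.zero_rpow (by linarith)]
  field_simp
  ring

lemma integral_integral_weyl_covariance {α s : ℝ} (hα : 0 < α) (hα' : α < 1 / 2) (hs : 0 < s) :
    ∫ x in (0 : ℝ)..s, ∫ y in (0 : ℝ)..s,
      ((s ^ (-α) / s) ^ 2 * s + s ^ (-α) / s * α * (x ^ (-α) + y ^ (-α))
        + α ^ 2 * x ^ (-1 - α) * (y ^ (-1 - α) * min x y))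
      = s ^ (1 - 2 * α) / (1 - 2 * α) := by
  have h1 : (1 - α) ≠ 0 := by linarith
  have h2 : (1 - 2 * α) ≠ 0 := by linarith
  have e1 : s ^ (1 - α) = s * s ^ (-α) := by
    rw [← Real.rpow_one_add' hs.le (by linarith)]; ring_nf
  have e2 : s ^ (1 - 2 * α) = s * (s ^ (-α)) ^ 2 := by
    rw [← Real.rpow_natCast, ← Real.rpow_mul hs.le,
      ← Real.rpow_one_add' hs.le (by push_cast; linarith)]
    push_cast; ring_nf
  have hinner : ∀ x ∈ Set.Ioo 0 s, ∫ y in (0 : ℝ)..s,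
      ((s ^ (-α) / s) ^ 2 * s + s ^ (-α) / s * α * (x ^ (-α) + y ^ (-α))
        + α ^ 2 * x ^ (-1 - α) * (y ^ (-1 - α) * min x y))
      = (s ^ (-α)) ^ 2 / (1 - α) + α / (1 - α) * x ^ (-(2 * α)) := by
    intro x hx
    have hx0 := hx.1
    obtain ⟨hi, hv⟩ := integral_rpow_mul_min hα (by linarith) hx0 hx.2.le
    have ip : IntervalIntegrable (fun y : ℝ => y ^ (-α)) volume 0 s :=
      intervalIntegral.intervalIntegrable_rpow' (by linarith)
    rw [intervalIntegral.integral_add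
        (intervalIntegrable_const.add ((intervalIntegrable_const.add ip).const_mul _))
        (hi.const_mul _),
      intervalIntegral.integral_add intervalIntegrable_const
        ((intervalIntegrable_const.add ip).const_mul _),
      intervalIntegral.integral_const_mul (α ^ 2 * x ^ (-1 - α)),
      intervalIntegral.integral_const_mul (s ^ (-α) / s * α),
      intervalIntegral.integral_add intervalIntegrable_const ip, hv,
      integral_rpow (Or.inl (by linarith)), intervalIntegral.integral_const,
      intervalIntegral.integral_const, show -α + 1 = 1 - α by ring, Real.zero_rpow h1]
    have f1 : x ^ (1 - α) = x * x ^ (-α) := by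
      rw [← Real.rpow_one_add' hx0.le (by linarith)]; ring_nf
    have f2 : x ^ (-1 - α) = x ^ (-α) / x := by
      rw [show -1 - α = -α - 1 by ring, Real.rpow_sub_one hx0.ne']
    have f3 : x ^ (-(2 * α)) = (x ^ (-α)) ^ 2 := by
      rw [← Real.rpow_natCast, ← Real.rpow_mul hx0.le]
      push_cast; ring_nf
    rw [f1, f2, f3, e1]
    simp only [smul_eq_mul]
    generalize s ^ (-α) = a
    generalize x ^ (-α) = b
    field_simp
    ring
  rw [intervalIntegral.integral_congr_Ioo_of_le hs.le hinner,
    intervalIntegral.integral_add intervalIntegrable_const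
      ((intervalIntegral.intervalIntegrable_rpow' (by linarith)).const_mul _),
    intervalIntegral.integral_const_mul, integral_rpow (Or.inl (by linarith)),
    intervalIntegral.integral_const, show -(2 * α) + 1 = 1 - 2 * α by ring, Real.zero_rpow h2, e2]
  simp only [smul_eq_mul]
  generalize s ^ (-α) = a
  have h3 : 1 - α * 2 ≠ 0 := by rwa [mul_comm]
  field_simp
  ring

/-- The second moment of the Weyl form at `s`, for a process `W` (such as the time reversal
`W x = B s - B (s - x)`) with the covariance of Brownian motion on `(0, s]`. -/
lemma integral_weyl_sq {Ω : Type*} [MeasurableSpace Ω] {μ : Measure Ω} [IsProbabilityMeasure μ]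
    {W : ℝ → Ω → ℝ} (hmeas : Measurable fun q : ℝ × Ω => W q.1 q.2) {α s : ℝ} (hα : 0 < α)
    (hα' : α < 1 / 2) (hs : 0 < s) (hL2 : ∀ x ∈ Set.Ioc 0 s, MemLp (W x) 2 μ)
    (hcov : ∀ x ∈ Set.Ioc 0 s, ∀ y ∈ Set.Ioc 0 s, ∫ ω, W x ω * W y ω ∂μ = min x y) :
    ∫ ω, (W s ω / s ^ α + α * ∫ x in (0 : ℝ)..s, W x ω / x ^ (1 + α)) ^ 2 ∂μ
      = s ^ (1 - 2 * α) / (1 - 2 * α) := by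
  set c : ℝ := s ^ (-α) / s with hc
  have hc0 : 0 < c := by positivity
  have hsm : s ∈ Set.Ioc 0 s := ⟨hs, le_rfl⟩
  let F : ℝ → Ω → ℝ := fun x ω => c * W s ω + α * (W x ω * x ^ (-1 - α))
  have hF : Measurable fun q : ℝ × Ω => F q.1 q.2 := by
    have : Measurable fun q : ℝ × Ω => W s q.2 :=
      hmeas.comp (by fun_prop : Measurable fun q : ℝ × Ω => (s, q.2))
    exact (this.const_mul c).add ((hmeas.mul (measurable_fst.pow_const _)).const_mul α)
  have hFF : ∀ x ∈ Set.Ioc 0 s, ∀ y ∈ Set.Ioc 0 s, ∫ ω, F x ω * F y ω ∂μ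
      = c ^ 2 * s + c * α * (x ^ (-α) + y ^ (-α))
        + α ^ 2 * x ^ (-1 - α) * (y ^ (-1 - α) * min x y) := by
    intro x hx y hy
    have i1 : Integrable (fun ω => W s ω * W s ω) μ :=
      (hL2 s hsm).integrable_mul (hL2 s hsm)
    have i2 : Integrable (fun ω => W s ω * W x ω) μ :=
      (hL2 s hsm).integrable_mul (hL2 x hx)
    have i3 : Integrable (fun ω => W s ω * W y ω) μ :=
      (hL2 s hsm).integrable_mul (hL2 y hy)
    have i4 : Integrable (fun ω => W x ω * W y ω) μ :=
      (hL2 x hx).integrable_mul (hL2 y hy)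
    have hexp : ∀ ω, F x ω * F y ω = c ^ 2 * (W s ω * W s ω)
        + c * α * x ^ (-1 - α) * (W s ω * W x ω) + c * α * y ^ (-1 - α) * (W s ω * W y ω)
        + α ^ 2 * x ^ (-1 - α) * y ^ (-1 - α) * (W x ω * W y ω) := fun ω => by
      simp only [F]; ring
    have hpow : ∀ z ∈ Set.Ioc 0 s, z ^ (-α) = z ^ (-1 - α) * z := fun z hz => by
      rw [← Real.rpow_add_one hz.1.ne']; ring_nf
    simp_rw [hexp]
    rw [integral_add (by fun_prop) (by fun_prop), integral_add (by fun_prop) (by fun_prop),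
      integral_add (by fun_prop) (by fun_prop)]
    simp_rw [integral_const_mul]
    rw [hcov s hsm s hsm, hcov s hsm x hx, hcov s hsm y hy, hcov x hx y hy, min_self,
      min_eq_right hx.2, min_eq_right hy.2, hpow x hx, hpow y hy]
    ring
  have hFL2 : ∀ x ∈ Set.Ioc 0 s, MemLp (F x) 2 μ := fun x hx =>
    ((hL2 s hsm).const_mul c).add (((hL2 x hx).mul_const _).const_mul α)
  let g : ℝ → ℝ := fun x => c * s ^ (1 / 2 : ℝ) + α * x ^ (-1 / 2 - α)
  have hg : Integrable g (volume.restrict (Set.Ioc 0 s)) := by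
    rw [← IntegrableOn, ← intervalIntegrable_iff_integrableOn_Ioc_of_le hs.le]
    exact intervalIntegrable_const.add
      ((intervalIntegral.intervalIntegrable_rpow' (by linarith)).const_mul _)
  have hbound : ∀ᵐ x ∂(volume.restrict (Set.Ioc 0 s)),
      0 < g x ∧ MemLp (F x) 2 μ ∧ ∫ ω, F x ω ^ 2 ∂μ ≤ g x ^ 2 := by
    refine ae_restrict_of_forall_mem measurableSet_Ioc fun x hx => ⟨?_, hFL2 x hx, ?_⟩
    · have := Real.rpow_pos_of_pos hx.1 (-1 / 2 - α)
      positivity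
    · have hx0 := hx.1
      simp_rw [sq (F x _)]
      rw [hFF x hx x hx, min_self]
      set p := x ^ (1 / 2 : ℝ) with hp
      set q := s ^ (1 / 2 : ℝ) with hq
      set r := x ^ (-1 / 2 - α) with hr
      have hpq : p ≤ q := Real.rpow_le_rpow hx0.le hx.2 (by norm_num)
      have hr0 : 0 < r := Real.rpow_pos_of_pos hx0 _
      have hs2 : s = q ^ 2 := by
        rw [hq, ← Real.rpow_natCast, ← Real.rpow_mul hs.le]; norm_num
      have ha : x ^ (-α) = r * p := by rw [hr, hp, ← Real.rpow_add hx0]; ring_nf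
      have hb : x ^ (-1 - α) * (x ^ (-1 - α) * x) = r ^ 2 := by
        rw [← Real.rpow_add_one hx0.ne', ← Real.rpow_add hx0, hr, ← Real.rpow_natCast,
          ← Real.rpow_mul hx0.le]
        push_cast; ring_nf
      calc c ^ 2 * s + c * α * (x ^ (-α) + x ^ (-α))
            + α ^ 2 * x ^ (-1 - α) * (x ^ (-1 - α) * x)
          = c ^ 2 * q ^ 2 + 2 * (c * α * (r * p)) + α ^ 2 * r ^ 2 := by
            rw [mul_assoc (α ^ 2), hb, ha, hs2]; ring
        _ ≤ c ^ 2 * q ^ 2 + 2 * (c * α * (r * q)) + α ^ 2 * r ^ 2 := by gcongr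
        _ = (c * q + α * r) ^ 2 := by ring
  have hpath : ∀ᵐ ω ∂μ, W s ω / s ^ α + α * ∫ x in (0 : ℝ)..s, W x ω / x ^ (1 + α)
      = ∫ x in Set.Ioc 0 s, F x ω := by
    filter_upwards [ae_integrable_of_integral_sq_le hF hg hbound] with ω hω
    have hi : Integrable (fun x => α * (W x ω * x ^ (-1 - α)))
        (volume.restrict (Set.Ioc 0 s)) :=
      (hω.sub (integrable_const (c * W s ω))).congr (.of_forall fun x => by simp [F])
    have hk : ∀ x ∈ Set.Ioc 0 s, W x ω / x ^ (1 + α) = W x ω * x ^ (-1 - α) := fun x hx => by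
      rw [show -1 - α = -(1 + α) by ring, Real.rpow_neg hx.1.le, div_eq_mul_inv]
    rw [integral_add (integrable_const _) hi, integral_const_mul α,
      intervalIntegral.integral_of_le hs.le, setIntegral_congr_fun measurableSet_Ioc hk]
    simp only [integral_const, measureReal_restrict_apply_univ, Real.volume_real_Ioc_of_le hs.le,
      smul_eq_mul, sub_zero, hc, Real.rpow_neg hs.le]
    field_simp
  rw [integral_congr_ae (hpath.mono fun ω h => congrArg (· ^ 2) h),
    integral_sq_integral_eq hF hg hbound, ← integral_integral_weyl_covariance hα hα' hs,
    intervalIntegral.integral_of_le hs.le]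
  refine setIntegral_congr_fun measurableSet_Ioc fun x hx => ?_
  simp only [intervalIntegral.integral_of_le hs.le]
  exact setIntegral_congr_fun measurableSet_Ioc fun y hy => hFF x hx y hy

/-- For a standard one-dimensional Brownian motion `B` (a centered process with
continuous paths, `B(0) = 0` and covariance `E[B(u)B(v)] = min(u,v)`), for
`α ∈ (0,1/2)` and `s > 0`,
`E[(B(s)/s^α + α ∫₀ˢ (B(s)-B(u))/(s-u)^{1+α} du)²] = s^{1-2α}/(1-2α)`;
equivalently, the Weyl-form fractional derivative satisfies
`E|D^α_{0+}B(s)|² = s^{1-2α}/((1-2α) Γ(1-α)²)`. -/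
theorem stmt_18 {Ω : Type*} [MeasureSpace Ω] [IsProbabilityMeasure (volume : Measure Ω)]
    (B : ℝ → Ω → ℝ)
    (hmeas : Measurable fun q : ℝ × Ω => B q.1 q.2)
    (hcont : ∀ ω, Continuous fun t => B t ω)
    (h0 : ∀ ω, B 0 ω = 0)
    (hmean : ∀ t : ℝ, 0 ≤ t → (∫ ω, B t ω) = 0)
    (hcov : ∀ u v : ℝ, 0 ≤ u → 0 ≤ v → (∫ ω, B u ω * B v ω) = min u v)
    (α s : ℝ) (hα : α ∈ Set.Ioo (0:ℝ) (1/2)) (hs : 0 < s) :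
    (∫ ω, (B s ω / s ^ α +
        α * ∫ u in (0:ℝ)..s, (B s ω - B u ω) / (s - u) ^ (1 + α)) ^ 2)
      = s ^ (1 - 2 * α) / (1 - 2 * α) ∧
    (∫ ω, ((1 / Real.Gamma (1 - α)) * (B s ω / s ^ α +
        α * ∫ u in (0:ℝ)..s, (B s ω - B u ω) / (s - u) ^ (1 + α))) ^ 2)
      = s ^ (1 - 2 * α) / ((1 - 2 * α) * Real.Gamma (1 - α) ^ 2) := by
  have hL2 : ∀ t, 0 ≤ t → MemLp (B t) 2 := by
    intro t ht
    refine (memLp_two_iff_integrable_sq (hmeas.comp (by fun_prop :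
      Measurable fun ω : Ω => (t, ω))).aestronglyMeasurable).2 ?_
    rcases ht.eq_or_lt with rfl | ht
    · simp [h0]
    · refine Integrable.of_integral_ne_zero ?_
      have hvar : ∫ ω, B t ω ^ 2 = t := by
        simp_rw [sq, hcov t t ht.le ht.le, min_self]
      exact hvar.trans_ne ht.ne'
  have hinc : ∀ x ∈ Set.Ioc 0 s, MemLp (fun ω => B s ω - B (s - x) ω) 2 := fun x hx =>
    (hL2 s hs.le).sub (hL2 _ (sub_nonneg.2 hx.2))
  have hinc_cov : ∀ x ∈ Set.Ioc 0 s, ∀ y ∈ Set.Ioc 0 s,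
      ∫ ω, (B s ω - B (s - x) ω) * (B s ω - B (s - y) ω) = min x y := by
    intro x hx y hy
    have hx' := sub_nonneg.2 hx.2
    have hy' := sub_nonneg.2 hy.2
    have i1 : Integrable fun ω => B s ω * B s ω :=
      (hL2 s hs.le).integrable_mul (hL2 s hs.le)
    have i2 : Integrable fun ω => B s ω * B (s - y) ω :=
      (hL2 s hs.le).integrable_mul (hL2 _ hy')
    have i3 : Integrable fun ω => B (s - x) ω * B s ω :=
      (hL2 _ hx').integrable_mul (hL2 s hs.le)
    have i4 : Integrable fun ω => B (s - x) ω * B (s - y) ω :=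
      (hL2 _ hx').integrable_mul (hL2 _ hy')
    have hexp : ∀ ω, (B s ω - B (s - x) ω) * (B s ω - B (s - y) ω)
        = B s ω * B s ω - B s ω * B (s - y) ω
          - (B (s - x) ω * B s ω - B (s - x) ω * B (s - y) ω) := fun ω => by ring
    simp_rw [hexp]
    rw [integral_sub (by fun_prop) (by fun_prop), integral_sub i1 i2, integral_sub i3 i4,
      hcov _ _ hs.le hs.le, hcov _ _ hs.le hy', hcov _ _ hx' hs.le, hcov _ _ hx' hy',
      min_self, min_eq_right (sub_le_self s hy.1.le), min_eq_left (sub_le_self s hx.1.le),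
      min_sub_sub_left]
    linarith [min_add_max x y]
  have hmeas' : Measurable fun q : ℝ × Ω => B s q.2 - B (s - q.1) q.2 :=
    (hmeas.comp (by fun_prop : Measurable fun q : ℝ × Ω => (s, q.2))).sub
      (hmeas.comp (by fun_prop : Measurable fun q : ℝ × Ω => (s - q.1, q.2)))
  have hrev : ∀ ω, ∫ u in (0:ℝ)..s, (B s ω - B u ω) / (s - u) ^ (1 + α)
      = ∫ x in (0:ℝ)..s, (B s ω - B (s - x) ω) / x ^ (1 + α) := fun ω => by
    simpa using (intervalIntegral.integral_comp_sub_left (a := 0) (b := s)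
      (fun x => (B s ω - B (s - x) ω) / x ^ (1 + α)) s)
  have main : (∫ ω, (B s ω / s ^ α +
      α * ∫ u in (0:ℝ)..s, (B s ω - B u ω) / (s - u) ^ (1 + α)) ^ 2)
      = s ^ (1 - 2 * α) / (1 - 2 * α) := by
    simpa [hrev, h0] using integral_weyl_sq (W := fun x ω => B s ω - B (s - x) ω)
      hmeas' hα.1 hα.2 hs hinc hinc_cov
  refine ⟨main, ?_⟩
  simp_rw [mul_pow]
  rw [integral_const_mul, main, one_div, inv_pow, inv_mul_eq_div, div_div]
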